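/- arXiv:1411.1464 — 12 statements merged into one kernel-verified Lean document; each statement's English description precedes it below -/
import Mathlib

section
/- Let X be a real normed linear space. Suppose that for all nonzero x, y in X, x ⊥_B y implies x ⊥_SB y (that is, whenever ‖x‖ ≤ ‖x + λy‖ for all real λ, one actually has ‖x‖ < ‖x + λy‖ for all real λ ≠ 0). Then X is strictly convex. -/
/-- If `x`, `y` are unit vectors with `‖x + y‖ = 2`, then `x + y` is Birkhoff-James orthogonal
to `x - y`. -/
theorem norm_add_le_norm_add_smul_sub {X : Type*} [NormedAddCommGroup X] [NormedSpace ℝ X]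
    {x y : X} (hx : ‖x‖ = 1) (hy : ‖y‖ = 1) (hxy : ‖x + y‖ = 2) (l : ℝ) :
    ‖x + y‖ ≤ ‖(x + y) + l • (x - y)‖ := by
  have e : (x + y) + l • (x - y) = (1 + l) • x + (1 - l) • y := by module
  have hnx : ‖(1 + l) • x‖ = |1 + l| := by rw [norm_smul, hx, mul_one, Real.norm_eq_abs]
  have hny : ‖(1 - l) • y‖ = |1 - l| := by rw [norm_smul, hy, mul_one, Real.norm_eq_abs]
  have h₁ := norm_sub_le_norm_add ((1 + l) • x) ((1 - l) • y)
  have h₂ := norm_sub_le_norm_add ((1 - l) • y) ((1 + l) • x)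
  rw [add_comm ((1 - l) • y)] at h₂
  rw [hnx, hny] at h₁ h₂
  have h₃ : ‖(2 : ℝ) • (x + y)‖ ≤
      ‖(1 + l) • x + (1 - l) • y‖ + (|1 - l| + |1 + l|) := by
    calc ‖(2 : ℝ) • (x + y)‖
        = ‖((1 + l) • x + (1 - l) • y) + ((1 - l) • x + (1 + l) • y)‖ := by
          congr 1; module
      _ ≤ ‖(1 + l) • x + (1 - l) • y‖ + (‖(1 - l) • x‖ + ‖(1 + l) • y‖) :=
          (norm_add_le _ _).trans (by gcongr; exact norm_add_le _ _)
      _ = _ := by simp only [norm_smul, hx, hy, mul_one, Real.norm_eq_abs]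
  rw [norm_smul, hxy, Real.norm_eq_abs, abs_two] at h₃
  rw [e, hxy]
  grind

/-- If in a real normed linear space, Birkhoff-James orthogonality of nonzero vectors
always implies strong Birkhoff-James orthogonality, then the space is strictly convex. -/
theorem stmt_0 (X : Type*) [NormedAddCommGroup X] [NormedSpace ℝ X]
    (h : ∀ x y : X, x ≠ 0 → y ≠ 0 →
      (∀ l : ℝ, ‖x‖ ≤ ‖x + l • y‖) → ∀ l : ℝ, l ≠ 0 → ‖x‖ < ‖x + l • y‖) :
    StrictConvexSpace ℝ X := by
  refine StrictConvexSpace.of_norm_add_ne_two fun x y hx hy hne hxy => ?_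
  have hxy₀ : x + y ≠ 0 := norm_ne_zero_iff.mp (by rw [hxy]; exact two_ne_zero)
  have hlt := h (x + y) (x - y) hxy₀ (sub_ne_zero.mpr hne)
    (norm_add_le_norm_add_smul_sub hx hy hxy) 1 one_ne_zero
  have e : (x + y) + (1 : ℝ) • (x - y) = (2 : ℝ) • x := by module
  rw [e, norm_smul, hx, hxy, Real.norm_eq_abs, abs_two, mul_one] at hlt
  exact lt_irrefl _ hlt
end

section
/- Let X be a strictly convex real normed linear space and let x, y be nonzero elements of X with x ⊥_B y (i.e. ‖x‖ ≤ ‖x + λy‖ for all real λ). Then x ⊥_SB y, i.e. ‖x‖ < ‖x + λy‖ for all real λ ≠ 0. -/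
/-- In a strictly convex real normed linear space, Birkhoff-James orthogonality of
nonzero vectors implies strong Birkhoff-James orthogonality. -/
theorem stmt_1 (X : Type*) [NormedAddCommGroup X] [NormedSpace ℝ X]
    [StrictConvexSpace ℝ X] (x y : X) (hx : x ≠ 0) (hy : y ≠ 0)
    (h : ∀ l : ℝ, ‖x‖ ≤ ‖x + l • y‖) :
    ∀ l : ℝ, l ≠ 0 → ‖x‖ < ‖x + l • y‖ := by
  intro l hl
  by_contra! hle
  have hne : x ≠ x + l • y := by simp [hl, hy]
  have hlt : ‖(1 / 2 : ℝ) • x + (1 / 2 : ℝ) • (x + l • y)‖ < ‖x‖ :=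
    norm_combo_lt_of_ne le_rfl hle hne (by norm_num) (by norm_num) (by norm_num)
  have hmid : (1 / 2 : ℝ) • x + (1 / 2 : ℝ) • (x + l • y) = x + (l / 2) • y := by module
  rw [hmid] at hlt
  exact (h (l / 2)).not_gt hlt
end

section
/- Let X be a strictly convex real normed linear space, let n ≥ 2, and let x₁, x₂, …, xₙ be linearly independent unit vectors in X. If ‖x₁ + λ₂x₂ + ⋯ + λₙxₙ‖ ≥ 1 for all real scalars λ₂, …, λₙ, then ‖x₁ + λ₂x₂ + ⋯ + λₙxₙ‖ > 1 for all real scalars λ₂, …, λₙ with (λ₂, …, λₙ) ≠ (0, …, 0). -/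
/-- In a strictly convex real normed linear space, if x₁,…,xₙ are linearly independent
unit vectors with ‖x₁ + Σ_{j≥2} λⱼ xⱼ‖ ≥ 1 for all scalars, then the inequality is
strict whenever not all λⱼ (j ≥ 2) vanish. -/
theorem stmt_2 (X : Type*) [NormedAddCommGroup X] [NormedSpace ℝ X]
    [StrictConvexSpace ℝ X] (n : ℕ) (hn : 2 ≤ n) (x : Fin n → X)
    (i₁ : Fin n) (hi₁ : (i₁ : ℕ) = 0)
    (hli : LinearIndependent ℝ x) (hnorm : ∀ i, ‖x i‖ = 1)
    (h : ∀ l : Fin n → ℝ, 1 ≤ ‖x i₁ + ∑ j ∈ Finset.univ.erase i₁, l j • x j‖) :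
    ∀ l : Fin n → ℝ, (∃ j ∈ Finset.univ.erase i₁, l j ≠ 0) →
      1 < ‖x i₁ + ∑ j ∈ Finset.univ.erase i₁, l j • x j‖ := by
  rintro l ⟨j, hj, hlj⟩
  by_contra! hle
  set v := ∑ j ∈ Finset.univ.erase i₁, l j • x j with hv
  have hne : x i₁ ≠ x i₁ + v := fun heq =>
    hlj (linearIndependent_iff'.1 hli _ l (left_eq_add.1 heq) j hj)
  have hlt : ‖(1 / 2 : ℝ) • x i₁ + (1 / 2 : ℝ) • (x i₁ + v)‖ < 1 :=
    norm_combo_lt_of_ne (hnorm i₁).le hle hne (by norm_num) (by norm_num) (by norm_num)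
  have hmid : (1 / 2 : ℝ) • x i₁ + (1 / 2 : ℝ) • (x i₁ + v) =
      x i₁ + ∑ j ∈ Finset.univ.erase i₁, (1 / 2 * l j) • x j := by
    simp only [mul_smul, ← Finset.smul_sum, ← hv]
    module
  exact (h fun j => 1 / 2 * l j).not_gt (hmid ▸ hlt)
end

section
/- A real normed linear space X is strictly convex if and only if for all x, y in the unit sphere S_X, x ⊥_B y implies x ⊥_SB y (that is, whenever ‖x + λy‖ ≥ 1 for all real λ, one has ‖x + λy‖ > 1 for all real λ ≠ 0). -/
/-- If the midpoint of two unit vectors is a unit vector, then the whole line through them lies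
outside the open unit ball. -/
theorem one_le_norm_midpoint_add_smul_sub {X : Type*} [NormedAddCommGroup X] [NormedSpace ℝ X]
    {x y : X} (hx : ‖x‖ = 1) (hy : ‖y‖ = 1) (hxy : ‖x + y‖ = 2) (t : ℝ) :
    1 ≤ ‖(1 / 2 : ℝ) • (x + y) + t • (x - y)‖ := by
  wlog ht : 0 ≤ t generalizing x y t
  · have := this hy hx (by rwa [add_comm]) (-t) (by linarith)
    rwa [add_comm y x, neg_smul, ← smul_neg, neg_sub] at this
  set z := (1 / 2 : ℝ) • (x + y) + t • (x - y) with hz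
  have hcomb : ((t + 1 / 2) / 2) • (x + y) = (1 / 2 : ℝ) • z + t • y := by
    rw [hz]; module
  have hnorm := norm_add_le ((1 / 2 : ℝ) • z) (t • y)
  rw [← hcomb, norm_smul, norm_smul, norm_smul, hxy, hy, Real.norm_of_nonneg ht,
    Real.norm_of_nonneg (by positivity), Real.norm_of_nonneg (by positivity)] at hnorm
  linarith

/-- A real normed linear space is strictly convex iff for all unit vectors x, y,
Birkhoff-James orthogonality implies strong Birkhoff-James orthogonality. -/
theorem stmt_3 (X : Type*) [NormedAddCommGroup X] [NormedSpace ℝ X] :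
    StrictConvexSpace ℝ X ↔
      ∀ x y : X, ‖x‖ = 1 → ‖y‖ = 1 →
        (∀ l : ℝ, 1 ≤ ‖x + l • y‖) → ∀ l : ℝ, l ≠ 0 → 1 < ‖x + l • y‖ := by
  constructor
  · intro _ x y hx hy h l hl
    refine lt_of_le_of_ne (h l) fun heq => ?_
    have hy0 : y ≠ 0 := norm_ne_zero_iff.1 (by simp [hy])
    have hne : x ≠ x + l • y := by simp [hl, hy0]
    have hlt := (norm_midpoint_lt_iff (hx.trans heq)).2 hne
    have hmid : (1 / 2 : ℝ) • (x + (x + l • y)) = x + (l / 2) • y := by module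
    rw [hmid, hx] at hlt
    exact (h (l / 2)).not_gt hlt
  · intro h
    refine StrictConvexSpace.of_norm_add_ne_two fun x y hx hy hne hxy => ?_
    have hd : ‖x - y‖ ≠ 0 := norm_ne_zero_iff.2 (sub_ne_zero.2 hne)
    have hlt := h ((1 / 2 : ℝ) • (x + y)) (‖x - y‖⁻¹ • (x - y))
      (by rw [norm_smul, hxy]; norm_num)
      (by rw [norm_smul, norm_inv, norm_norm, inv_mul_cancel₀ hd])
      (fun l => by
        rw [smul_smul]
        exact one_le_norm_midpoint_add_smul_sub hx hy hxy _)
      (1 / 2 * ‖x - y‖) (by positivity)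
    have hend : (1 / 2 : ℝ) • (x + y) + (1 / 2 : ℝ) • (x - y) = x := by module
    rw [smul_smul, mul_inv_cancel_right₀ hd, hend, hx] at hlt
    exact lt_irrefl _ hlt
end

section
/- Let X be a real normed linear space of dimension greater than 2. Then the norm of X arises from an inner product (i.e. X is an inner product space, equivalently the norm satisfies the parallelogram law) if and only if for all x, y in the unit sphere S_X, x ⊥_B y implies both x ⊥_SB y and y ⊥_SB x. -/
/-- Uniqueness of the Birkhoff-James orthogonal component, when orthogonality is symmetric and
strong on the unit sphere. -/
lemma eq_zero_of_orthogonal_add_smul {X : Type*} [NormedAddCommGroup X] [NormedSpace ℝ X]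
    (H : ∀ x y : X, x ≠ 0 → y ≠ 0 → (∀ l : ℝ, ‖x‖ ≤ ‖x + l • y‖) →
      ∀ l : ℝ, l ≠ 0 → ‖y‖ < ‖y + l • x‖)
    {x y : X} (hx : x ≠ 0) (c : ℝ) (h₁ : ∀ l : ℝ, ‖x‖ ≤ ‖x + l • y‖)
    (h₂ : ∀ l : ℝ, ‖x‖ ≤ ‖x + l • (y + c • x)‖) : c = 0 := by
  by_contra hc
  by_cases hy : y = 0
  · have := h₂ (-c⁻¹)
    simp [hy, smul_smul, hc, hx] at this
  by_cases hz : y + c • x = 0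
  · have := h₁ c⁻¹
    rw [eq_neg_of_add_eq_zero_left hz] at this
    simp [smul_smul, hc, hx] at this
  have a := H x y hx hy h₁ c hc
  have b := H x (y + c • x) hx hz h₂ (-c) (neg_ne_zero.2 hc)
  simp at b
  linarith

/-- The orthogonality condition on the unit sphere extends to all nonzero vectors. -/
lemma orthogonal_symm_of_unit {X : Type*} [NormedAddCommGroup X] [NormedSpace ℝ X]
    (H : ∀ x y : X, ‖x‖ = 1 → ‖y‖ = 1 → (∀ l : ℝ, 1 ≤ ‖x + l • y‖) →
      ∀ l : ℝ, l ≠ 0 → 1 < ‖y + l • x‖)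
    (x y : X) (hx : x ≠ 0) (hy : y ≠ 0) (h : ∀ l : ℝ, ‖x‖ ≤ ‖x + l • y‖)
    (l : ℝ) (hl : l ≠ 0) : ‖y‖ < ‖y + l • x‖ := by
  have hx' : 0 < ‖x‖ := norm_pos_iff.2 hx
  have hy' : 0 < ‖y‖ := norm_pos_iff.2 hy
  have key (u v : X) (hu : 0 < ‖u‖) (hv : 0 < ‖v‖) (l : ℝ) :
      ‖u + l • v‖ = ‖u‖ * ‖‖u‖⁻¹ • u + (l * ‖v‖ / ‖u‖) • ‖v‖⁻¹ • v‖ := by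
    have : ‖u‖ * ‖‖u‖⁻¹ • u + (l * ‖v‖ / ‖u‖) • ‖v‖⁻¹ • v‖ =
        ‖‖u‖ • (‖u‖⁻¹ • u + (l * ‖v‖ / ‖u‖) • ‖v‖⁻¹ • v)‖ := by
      rw [norm_smul, norm_norm]
    rw [this, smul_add, smul_smul, smul_smul, smul_smul, mul_inv_cancel₀ hu.ne', one_smul]
    congr 3
    field_simp
  have := H (‖x‖⁻¹ • x) (‖y‖⁻¹ • y) (by simp [norm_smul, hx]) (by simp [norm_smul, hy])
    (fun l ↦ ?_) (l * ‖x‖ / ‖y‖) (by positivity)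
  · rw [key y x hy' hx']
    nlinarith
  · have h' := h (l * ‖x‖ / ‖y‖)
    rw [key x y hx' hy', show l * ‖x‖ / ‖y‖ * ‖y‖ / ‖x‖ = l by field_simp] at h'
    exact le_of_mul_le_mul_left (by simpa using h') hx'

/-- A semi-inner product inducing the norm whose orthogonality relation is symmetric. -/
lemma exists_semiInner {X : Type*} [NormedAddCommGroup X] [NormedSpace ℝ X]
    (H : ∀ x y : X, x ≠ 0 → y ≠ 0 → (∀ l : ℝ, ‖x‖ ≤ ‖x + l • y‖) →
      ∀ l : ℝ, l ≠ 0 → ‖y‖ < ‖y + l • x‖) :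
    ∃ f : X → X →ₗ[ℝ] ℝ, (∀ x, f x x = ‖x‖ ^ 2) ∧ (∀ x y, |f x y| ≤ ‖x‖ * ‖y‖) ∧
      ∀ x y, f x y = 0 → f y x = 0 := by
  choose g hg hgx using fun x : X ↦ exists_dual_vector'' ℝ x
  have hle (x y : X) : |g x y| ≤ ‖y‖ := by
    simpa using (g x).le_of_opNorm_le (hg x) y
  have horth (x y : X) (h : g x y = 0) (l : ℝ) : ‖x‖ ≤ ‖x + l • y‖ := by
    have := (le_abs_self _).trans (hle x (x + l • y))
    simpa [h, hgx] using this
  refine ⟨fun x ↦ ‖x‖ • (g x).toLinearMap, fun x ↦ ?_, fun x y ↦ ?_, fun x y h ↦ ?_⟩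
  · simp [hgx, sq]
  · simpa [abs_mul] using mul_le_mul_of_nonneg_left (hle x y) (norm_nonneg x)
  by_cases hx : x = 0
  · simp [hx]
  by_cases hy : y = 0
  · simp [hy]
  have hgxy : g x y = 0 := by simpa [hx] using h
  have hy' : ‖y‖ ≠ 0 := norm_ne_zero_iff.2 hy
  have hyx (l : ℝ) : ‖y‖ ≤ ‖y + l • x‖ := by
    by_cases hl : l = 0
    · simp [hl]
    · exact (H x y hx hy (horth x y hgxy) l hl).le
  have := eq_zero_of_orthogonal_add_smul H hy (-(g y x / ‖y‖)) hyx
    (horth y _ (by simp [hgx, hy']))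
  simp [hy'] at this
  simp [this]

/-- In a plane spanned by orthogonal vectors, the functional attached to a point depends linearly
on it up to scaling, provided that there is a third orthogonal direction. -/
lemma exists_proportional {X : Type*} [AddCommGroup X] [Module ℝ X] (f : X → X →ₗ[ℝ] ℝ)
    (hpos : ∀ x, x ≠ 0 → f x x ≠ 0) (hsymm : ∀ x y, f x y = 0 → f y x = 0)
    {a b c : X} (ha : a ≠ 0) (hb : b ≠ 0) (hc : c ≠ 0)
    (hab : f a b = 0) (hac : f a c = 0) (hbc : f b c = 0) :
    ∃ α : ℝ, ∀ t : ℝ, f (a + t • b) b = α * t * f (a + t • b) a := by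
  have hba := hsymm _ _ hab
  have hca := hsymm _ _ hac
  have hcb := hsymm _ _ hbc
  have hadd {u v w : X} (hu : f u w = 0) (hv : f v w = 0) : f (u + v) w = 0 := by
    apply hsymm
    rw [map_add, hsymm _ _ hu, hsymm _ _ hv, add_zero]
  have hsmul {u w : X} (r : ℝ) (hu : f u w = 0) : f (r • u) w = 0 := by
    apply hsymm
    rw [map_smul, hsymm _ _ hu, smul_zero]
  -- nonvanishing of coordinates
  have hna (t s : ℝ) : f (a + t • b + s • c) a ≠ 0 := fun h ↦ by
    have := hsymm _ _ h
    simp [hab, hac, hpos a ha] at this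
  have hnab (t : ℝ) : f (a + t • b) a ≠ 0 := by simpa using hna t 0
  have hnac (t : ℝ) : f (a + t • c) a ≠ 0 := by simpa using hna 0 t
  have hnb (u : ℝ) : f (b + u • c) b ≠ 0 := fun h ↦ by
    have := hsymm _ _ h
    simp [hbc, hpos b hb] at this
  have hnc (u : ℝ) : f (c + u • b) c ≠ 0 := fun h ↦ by
    have := hsymm _ _ h
    simp [hcb, hpos c hc] at this
  obtain ⟨g, hg⟩ : ∃ g : ℝ → ℝ, ∀ t, f (a + t • b) b = g t * f (a + t • b) a :=
    ⟨fun t ↦ f (a + t • b) b / f (a + t • b) a, fun t ↦ (div_mul_cancel₀ _ (hnab t)).symm⟩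
  obtain ⟨h, hh⟩ : ∃ h : ℝ → ℝ, ∀ t, f (a + t • c) c = h t * f (a + t • c) a :=
    ⟨fun t ↦ f (a + t • c) c / f (a + t • c) a, fun t ↦ (div_mul_cancel₀ _ (hnac t)).symm⟩
  obtain ⟨k, hk⟩ : ∃ k : ℝ → ℝ, ∀ t, f (b + t • c) c = k t * f (b + t • c) b :=
    ⟨fun t ↦ f (b + t • c) c / f (b + t • c) b, fun t ↦ (div_mul_cancel₀ _ (hnb t)).symm⟩
  obtain ⟨m, hm⟩ : ∃ m : ℝ → ℝ, ∀ t, f (c + t • b) b = m t * f (c + t • b) c :=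
    ⟨fun t ↦ f (c + t • b) b / f (c + t • b) c, fun t ↦ (div_mul_cancel₀ _ (hnc t)).symm⟩
  have hG (t s : ℝ) : f (a + t • b + s • c) b = g t * f (a + t • b + s • c) a := by
    have := hadd (w := b - g t • a) (u := a + t • b) (v := s • c) (by simp [hg])
      (hsmul s (by simp [hcb, hca]))
    simpa [sub_eq_zero] using this
  have hH (t s : ℝ) : f (a + t • b + s • c) c = h s * f (a + t • b + s • c) a := by
    have := hadd (w := c - h s • a) (u := a + s • c) (v := t • b) (by simp [hh])
      (hsmul t (by simp [hbc, hba]))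
    rw [add_right_comm] at this
    simpa [sub_eq_zero] using this
  have hK (t u : ℝ) : h (t * u) = k u * g t := by
    have := hadd (w := c - k u • b) (u := a) (v := t • (b + u • c)) (by simp [hac, hab])
      (hsmul t (by simp [hk]))
    rw [smul_add, smul_smul, ← add_assoc, map_sub, map_smul, hG, hH, smul_eq_mul, ← mul_assoc,
      ← sub_mul] at this
    exact sub_eq_zero.1 ((mul_eq_zero.1 this).resolve_right (hna _ _))
  have hM (t s : ℝ) : g (t + s) = g t + m s * h 1 := by
    have := hadd (w := b - g t • a - m s • c) (u := a + t • b) (v := c + s • b)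
      (by
        have : f (a + t • b) c = 0 :=
          hadd hac (hsmul t hbc)
        simp [hg, this])
      (by
        have : f (c + s • b) a = 0 :=
          hadd hca (hsmul s hba)
        simp [hm, this])
    rw [show a + t • b + (c + s • b) = a + (t + s) • b + (1 : ℝ) • c by module, map_sub, map_sub,
      map_smul, map_smul, hG, hH, smul_eq_mul, smul_eq_mul, ← mul_assoc, ← sub_mul,
      ← sub_mul] at this
    have := (mul_eq_zero.1 this).resolve_right (hna _ _)
    linarith
  have hg0 : g 0 = 0 := by
    have := hg 0
    simpa [hab, hpos a ha] using this
  have hgadd (t s : ℝ) : g (t + s) = g t + g s := by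
    have := hM 0 s
    rw [zero_add, hg0, zero_add] at this
    rw [hM, this]
  have hg1 : g 1 ≠ 0 := fun h0 ↦ by
    have := hg 1
    rw [h0, zero_mul] at this
    have := hsymm _ _ this
    simp [hba, hpos b hb] at this
  have hk1 : k 1 ≠ 0 := fun h0 ↦ by
    have := hk 1
    rw [h0, zero_mul] at this
    have := hsymm _ _ this
    simp [hcb, hpos c hc] at this
  have hgmul (t u : ℝ) : g (t * u) * g 1 = g t * g u := by
    have h1 := hK (t * u) 1
    have h2 := hK t u
    have h3 := hK u 1
    have h4 := hK 1 u
    simp only [mul_one, one_mul] at h1 h3 h4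
    apply mul_left_cancel₀ hk1
    linear_combination (-g 1) * h1 + g 1 * h2 + g t * (h3 - h4)
  let φ : ℝ →+* ℝ :=
    { toFun t := g t / g 1
      map_one' := div_self hg1
      map_mul' t u := by
        have := hgmul t u
        field_simp
        linarith
      map_zero' := by simp [hg0]
      map_add' t u := by rw [hgadd, add_div] }
  refine ⟨g 1, fun t ↦ ?_⟩
  have : g t / g 1 = t := congrArg (fun ψ : ℝ →+* ℝ ↦ ψ t) (Subsingleton.elim φ (RingHom.id ℝ))
  rw [hg, (div_eq_iff hg1).1 this, mul_comm t]

/-- A function whose increments are locally quadratic is constant. -/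
lemma eq_of_sub_le_mul_sq {D : ℝ → ℝ} (hD : Continuous D) {C : ℝ}
    (h : ∀ t s, |D s - D t| ≤ C * (|D t| + |D s|) * (s - t) ^ 2) (t s : ℝ) : D t = D s := by
  have hder (t : ℝ) : HasDerivAt D 0 t := by
    rw [hasDerivAt_iff_tendsto_slope]
    apply squeeze_zero_norm' (a := fun s ↦ C * (|D t| + |D s|) * |s - t|)
    · filter_upwards [self_mem_nhdsWithin] with s hs
      have hpos : 0 < |s - t| := abs_pos.2 (sub_ne_zero.2 hs)
      rw [slope_def_field, Real.norm_eq_abs, abs_div, div_le_iff₀ hpos, mul_assoc, abs_mul_abs_self,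
        ← sq]
      exact h t s
    · have : Continuous fun s ↦ C * (|D t| + |D s|) * |s - t| := by fun_prop
      exact (this.tendsto' t 0 (by simp)).mono_left nhdsWithin_le_nhds
  exact is_const_of_deriv_eq_zero (fun t ↦ (hder t).differentiableAt) (fun t ↦ (hder t).deriv) t s

/-- The norm is Euclidean on a plane where the supporting functionals are linear up to scaling. -/
lemma norm_sq_add_of_proportional {X : Type*} [NormedAddCommGroup X] [NormedSpace ℝ X]
    (f : X → X →ₗ[ℝ] ℝ) (hself : ∀ x, f x x = ‖x‖ ^ 2) (hle : ∀ x y, |f x y| ≤ ‖x‖ * ‖y‖)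
    {a b : X} (ha : ‖a‖ = 1) (hne : ∀ t : ℝ, a + t • b ≠ 0) {α : ℝ}
    (hα : ∀ t : ℝ, f (a + t • b) b = α * t * f (a + t • b) a) (r s : ℝ) :
    ‖r • a + s • b‖ ^ 2 = r ^ 2 + s ^ 2 * ‖b‖ ^ 2 := by
  have hN (t : ℝ) : 0 < ‖a + t • b‖ := norm_pos_iff.2 (hne t)
  have hself' (t : ℝ) : f (a + t • b) a * (1 + α * t ^ 2) = ‖a + t • b‖ ^ 2 := by
    rw [← hself]
    conv_rhs => rw [map_add, map_smul, hα, smul_eq_mul]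
    ring
  have hα0 : 0 ≤ α := by
    by_contra! hneg
    have h1 := hself' (Real.sqrt (-α⁻¹))
    rw [Real.sq_sqrt (by simpa using hneg.le)] at h1
    have : α * -α⁻¹ = -1 := by field_simp [hneg.ne]
    rw [this] at h1
    have := hN (Real.sqrt (-α⁻¹))
    nlinarith
  have hq (t : ℝ) : 1 ≤ 1 + α * t ^ 2 := by nlinarith [mul_nonneg hα0 (sq_nonneg t)]
  have hq0 (t : ℝ) : 0 < 1 + α * t ^ 2 := one_pos.trans_le (hq t)
  have hineq (t s : ℝ) : ‖a + t • b‖ * |1 + α * t * s| ≤ ‖a + s • b‖ * (1 + α * t ^ 2) := by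
    have h1 := hle (a + t • b) (a + s • b)
    have h2 : f (a + t • b) (a + s • b) = f (a + t • b) a * (1 + α * t * s) := by
      rw [map_add, map_smul, hα, smul_eq_mul]
      ring
    have h3 : f (a + t • b) a = ‖a + t • b‖ ^ 2 / (1 + α * t ^ 2) :=
      eq_div_of_mul_eq (hq0 t).ne' (hself' t)
    rw [h2, h3, abs_mul, abs_of_nonneg (by have := hq0 t; positivity), div_mul_eq_mul_div,
      div_le_iff₀ (hq0 t)] at h1
    refine le_of_mul_le_mul_left ?_ (hN t)
    linarith
  let D : ℝ → ℝ := fun t ↦ ‖a + t • b‖ ^ 2 / (1 + α * t ^ 2)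
  have hDpos (t : ℝ) : 0 < D t := div_pos (pow_pos (hN t) 2) (hq0 t)
  have hDN (t : ℝ) : ‖a + t • b‖ ^ 2 = D t * (1 + α * t ^ 2) :=
    (div_mul_cancel₀ _ (hq0 t).ne').symm
  have hDc : Continuous D := by
    refine Continuous.div (by fun_prop) (by fun_prop) fun t ↦ (hq0 t).ne'
  have hDle (t s : ℝ) : D t - D s ≤ α * D t * (s - t) ^ 2 := by
    have h1 := pow_le_pow_left₀ (by positivity) (hineq t s) 2
    rw [mul_pow, mul_pow, sq_abs, hDN, hDN] at h1
    have h2 : D t * (1 + α * t * s) ^ 2 ≤ D s * ((1 + α * s ^ 2) * (1 + α * t ^ 2)) := by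
      refine le_of_mul_le_mul_left ?_ (hq0 t)
      linarith
    have h3 : (D t - D s) * ((1 + α * s ^ 2) * (1 + α * t ^ 2)) ≤ α * D t * (s - t) ^ 2 := by
      linarith
    have h4 : 1 ≤ (1 + α * s ^ 2) * (1 + α * t ^ 2) := one_le_mul_of_one_le_of_one_le (hq s) (hq t)
    have h5 : 0 ≤ α * D t * (s - t) ^ 2 := by have := hDpos t; positivity
    by_contra! h6
    nlinarith
  have hconst (t : ℝ) : ‖a + t • b‖ ^ 2 = 1 + α * t ^ 2 := by
    have h0 : D t = D 0 := eq_of_sub_le_mul_sq hDc (C := α) (fun t s ↦ by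
      have h1 : 0 ≤ α * D t * (s - t) ^ 2 := by have := hDpos t; positivity
      have h2 : 0 ≤ α * D s * (s - t) ^ 2 := by have := hDpos s; positivity
      rw [abs_of_pos (hDpos t), abs_of_pos (hDpos s), abs_le]
      constructor <;> linarith [hDle t s, hDle s t]) t 0
    rw [hDN, h0]
    simp [D, ha]
  have hscale (r s : ℝ) (hr : r ≠ 0) : ‖r • a + s • b‖ ^ 2 = r ^ 2 + α * s ^ 2 := by
    have : r • a + s • b = r • (a + (s / r) • b) := by
      rw [smul_add, smul_smul, mul_div_cancel₀ _ hr]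
    rw [this, norm_smul, mul_pow, hconst, Real.norm_eq_abs, sq_abs]
    field_simp
  have hall (s : ℝ) : (fun r : ℝ ↦ ‖r • a + s • b‖ ^ 2) = fun r ↦ r ^ 2 + α * s ^ 2 :=
    Continuous.ext_on (dense_compl_singleton (0 : ℝ)) (by fun_prop) (by fun_prop)
      fun r hr ↦ hscale r s hr
  have hb := congrFun (hall 1) 0
  simp only [zero_smul, one_smul, zero_add] at hb
  rw [congrFun (hall s) r, hb]
  ring

/-- In dimension greater than two, a normed space whose norm comes from a semi-inner product with
symmetric orthogonality satisfies the parallelogram law. -/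
lemma parallelogram_of_semiInner {X : Type*} [NormedAddCommGroup X] [NormedSpace ℝ X]
    (hdim : 2 < Module.rank ℝ X) (f : X → X →ₗ[ℝ] ℝ) (hself : ∀ x, f x x = ‖x‖ ^ 2)
    (hle : ∀ x y, |f x y| ≤ ‖x‖ * ‖y‖) (hsymm : ∀ x y, f x y = 0 → f y x = 0) (x y : X) :
    ‖x + y‖ ^ 2 + ‖x - y‖ ^ 2 = 2 * ‖x‖ ^ 2 + 2 * ‖y‖ ^ 2 := by
  by_cases hx : x = 0
  · simp [hx]
    ring
  have hx' : ‖x‖ ≠ 0 := norm_ne_zero_iff.2 hx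
  obtain ⟨a, ha, hxa⟩ : ∃ a : X, ‖a‖ = 1 ∧ x = ‖x‖ • a :=
    ⟨‖x‖⁻¹ • x, by simp [norm_smul, hx'], by simp [smul_smul, hx']⟩
  have ha0 : a ≠ 0 := norm_ne_zero_iff.1 (by simp [ha])
  have hfa : f a a = 1 := by simp [hself, ha]
  obtain ⟨b, c, hab, hyb⟩ : ∃ (b : X) (c : ℝ), f a b = 0 ∧ y = c • a + b :=
    ⟨y - f a y • a, f a y, by simp [hfa], by simp⟩
  suffices h : ∀ r s : ℝ, ‖r • a + s • b‖ ^ 2 = r ^ 2 + s ^ 2 * ‖b‖ ^ 2 by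
    have h1 := h (‖x‖ + c) 1
    have h2 := h (‖x‖ - c) (-1)
    have h3 := h c 1
    have e1 : x + y = (‖x‖ + c) • a + (1 : ℝ) • b := by
      rw [hyb]; nth_rw 1 [hxa]; module
    have e2 : x - y = (‖x‖ - c) • a + (-1 : ℝ) • b := by
      rw [hyb]; nth_rw 1 [hxa]; module
    have e3 : y = c • a + (1 : ℝ) • b := by rw [hyb, one_smul]
    rw [e1, e2, h1, h2, e3, h3]
    ring
  by_cases hb : b = 0
  · simp [hb, norm_smul, ha]
  have hpos (x : X) (hx : x ≠ 0) : f x x ≠ 0 := by simp [hself, hx]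
  classical
  obtain ⟨z, hz⟩ : ∃ z, z ∉ Submodule.span ℝ (({a, b} : Finset X) : Set X) := by
    by_contra! h
    have htop : Submodule.span ℝ (({a, b} : Finset X) : Set X) = ⊤ := by
      rw [eq_top_iff]; exact fun z _ ↦ h z
    have h1 := rank_span_finset_le (R := ℝ) ({a, b} : Finset X)
    rw [htop, rank_top] at h1
    have h2 : ((({a, b} : Finset X).card : ℕ) : Cardinal) ≤ 2 := by
      exact_mod_cast Finset.card_le_two
    exact absurd hdim (not_lt.2 (h1.trans h2))
  have hba := hsymm _ _ hab
  let w : X := z - f a z • a - (f b z / f b b) • b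
  have hw : w ≠ 0 := fun h0 ↦ hz <| by
    have : z = f a z • a + (f b z / f b b) • b := by
      rw [← sub_eq_zero, ← sub_sub]; exact h0
    rw [this]
    exact add_mem (Submodule.smul_mem _ _ (Submodule.subset_span (by simp)))
      (Submodule.smul_mem _ _ (Submodule.subset_span (by simp)))
  obtain ⟨α, hα⟩ := exists_proportional f hpos hsymm ha0 hb hw hab
    (by simp [w, hfa, hab]) (by simp [w, hba, hpos b hb])
  refine norm_sq_add_of_proportional f hself hle ha (fun t ht ↦ ?_) hα
  have := congrArg (f a) ht
  simp [hfa, hab] at this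

/-- Under the parallelogram law, Birkhoff-James orthogonal unit vectors satisfy Pythagoras. -/
lemma norm_add_smul_sq_of_parallelogram {X : Type*} [NormedAddCommGroup X] [NormedSpace ℝ X]
    (h : ∀ x y : X, ‖x + y‖ ^ 2 + ‖x - y‖ ^ 2 = 2 * ‖x‖ ^ 2 + 2 * ‖y‖ ^ 2)
    {x y : X} (hx : ‖x‖ = 1) (hy : ‖y‖ = 1) (hxy : ∀ l : ℝ, 1 ≤ ‖x + l • y‖) (r s : ℝ) :
    ‖r • x + s • y‖ ^ 2 = r ^ 2 + s ^ 2 := by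
  let _ : InnerProductSpace ℝ X := InnerProductSpace.ofNorm ℝ fun x y ↦ by
    have := h x y
    linarith
  have key (r s : ℝ) :
      ‖r • x + s • y‖ ^ 2 = r ^ 2 + 2 * (r * s * inner ℝ x y) + s ^ 2 := by
    rw [norm_add_sq_real, norm_smul, norm_smul, hx, hy, real_inner_smul_left,
      real_inner_smul_right]
    simp [mul_assoc]
  have h0 : inner ℝ x y = 0 := by
    have h1 := hxy (-inner ℝ x y)
    have h2 := key 1 (-inner ℝ x y)
    rw [one_smul] at h2
    have h3 := one_le_pow₀ h1 (n := 2)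
    have : inner ℝ x y ^ 2 = 0 := le_antisymm (by nlinarith) (sq_nonneg _)
    exact pow_eq_zero_iff two_ne_zero |>.1 this
  rw [key, h0]
  ring

/-- A real normed linear space of dimension greater than 2 is an inner product space
(its norm satisfies the parallelogram law) iff for all unit vectors x, y, Birkhoff-James
orthogonality x ⊥_B y implies both x ⊥_SB y and y ⊥_SB x. -/
theorem stmt_4 (X : Type*) [NormedAddCommGroup X] [NormedSpace ℝ X]
    (hdim : 2 < Module.rank ℝ X) :
    (∀ x y : X, ‖x + y‖ ^ 2 + ‖x - y‖ ^ 2 = 2 * ‖x‖ ^ 2 + 2 * ‖y‖ ^ 2) ↔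
      ∀ x y : X, ‖x‖ = 1 → ‖y‖ = 1 → (∀ l : ℝ, 1 ≤ ‖x + l • y‖) →
        (∀ l : ℝ, l ≠ 0 → 1 < ‖x + l • y‖) ∧ (∀ l : ℝ, l ≠ 0 → 1 < ‖y + l • x‖) := by
  constructor
  · intro h x y hx hy hxy
    have key := norm_add_smul_sq_of_parallelogram h hx hy hxy
    refine ⟨fun l hl ↦ ?_, fun l hl ↦ ?_⟩
    · have h1 := key 1 l
      rw [one_smul] at h1
      have : 0 < l ^ 2 := by positivity
      exact lt_of_pow_lt_pow_left₀ 2 (norm_nonneg _) (by linarith)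
    · have h1 := key l 1
      rw [one_smul, add_comm] at h1
      have : 0 < l ^ 2 := by positivity
      exact lt_of_pow_lt_pow_left₀ 2 (norm_nonneg _) (by linarith)
  · intro H
    obtain ⟨f, hself, hle, hsymm⟩ := exists_semiInner
      (orthogonal_symm_of_unit fun x y hx hy hxy ↦ (H x y hx hy hxy).2)
    exact parallelogram_of_semiInner hdim f hself hle hsymm
end

section
/- Let X be a real normed linear space and let x, y be unit vectors in X with ‖x + λy‖ ≥ 1 for all real λ. Then ‖tx + (1−t)y‖ ≥ 1/3 for all t ∈ [0,1]. -/
/-- If x, y are unit vectors in a real normed linear space with x ⊥_B y, then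
‖tx + (1−t)y‖ ≥ 1/3 for all t ∈ [0,1]. -/
theorem stmt_5 (X : Type*) [NormedAddCommGroup X] [NormedSpace ℝ X]
    (x y : X) (hx : ‖x‖ = 1) (hy : ‖y‖ = 1)
    (h : ∀ l : ℝ, 1 ≤ ‖x + l • y‖) :
    ∀ t : ℝ, t ∈ Set.Icc (0 : ℝ) 1 → (1 : ℝ) / 3 ≤ ‖t • x + (1 - t) • y‖ := by
  rintro t ⟨ht0, ht1⟩
  rcases le_total t (1 / 3) with ht | ht
  · have htri : ‖(1 - t) • y‖ ≤ ‖t • x + (1 - t) • y‖ + ‖t • x‖ := by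
      simpa using norm_sub_le (t • x + (1 - t) • y) (t • x)
    rw [norm_smul, norm_smul, hx, hy, Real.norm_of_nonneg ht0,
      Real.norm_of_nonneg (sub_nonneg.2 ht1)] at htri
    linarith
  · have htpos : 0 < t := by linarith
    have hfactor : t • x + (1 - t) • y = t • (x + ((1 - t) / t) • y) := by
      rw [smul_add, smul_smul, mul_div_cancel₀ _ htpos.ne']
    rw [hfactor, norm_smul, Real.norm_of_nonneg ht0]
    nlinarith [h ((1 - t) / t)]
end

section
/- Let X be a strictly convex real normed linear space and let x, y be unit vectors in X with ‖x + λy‖ ≥ 1 for all real λ. Then ‖tx + (1−t)y‖ > 1/3 for all t ∈ [0,1]. -/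
/-- If x, y are unit vectors in a strictly convex real normed linear space with x ⊥_B y,
then ‖tx + (1−t)y‖ > 1/3 for all t ∈ [0,1]. -/
theorem stmt_6 (X : Type*) [NormedAddCommGroup X] [NormedSpace ℝ X]
    [StrictConvexSpace ℝ X]
    (x y : X) (hx : ‖x‖ = 1) (hy : ‖y‖ = 1)
    (h : ∀ l : ℝ, 1 ≤ ‖x + l • y‖) :
    ∀ t : ℝ, t ∈ Set.Icc (0 : ℝ) 1 → (1 : ℝ) / 3 < ‖t • x + (1 - t) • y‖ := by
  rintro t ⟨ht0, ht1⟩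
  rcases lt_trichotomy t (1 / 3) with ht | rfl | ht
  · have key := norm_sub_norm_le ((1 - t) • y) (-(t • x))
    rw [norm_neg, norm_smul, norm_smul, hx, hy, Real.norm_of_nonneg ht0,
      Real.norm_of_nonneg (by linarith), sub_neg_eq_add, add_comm _ (t • x)] at key
    linarith
  · have hne : x ≠ x + (2 : ℝ) • y := by
      have hy0 : y ≠ 0 := by
        rintro rfl
        simp at hy
      simpa using hy0
    have hz : (1 / 3 : ℝ) • x + (1 - 1 / 3 : ℝ) • y = (1 / 3 : ℝ) • (x + (2 : ℝ) • y) := by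
      module
    rw [hz, norm_smul, Real.norm_of_nonneg (by norm_num)]
    by_contra! hle
    have hlt := norm_combo_lt_of_ne (a := (1 / 2 : ℝ)) (b := 1 / 2) hx.le
      (show ‖x + (2 : ℝ) • y‖ ≤ 1 by linarith) hne (by norm_num) (by norm_num) (by norm_num)
    have hmid : (1 / 2 : ℝ) • x + (1 / 2 : ℝ) • (x + (2 : ℝ) • y) = x + (1 : ℝ) • y := by
      module
    rw [hmid] at hlt
    exact (h 1).not_gt hlt
  · have ht' : t ≠ 0 := by linarith
    have hz : t • x + (1 - t) • y = t • (x + ((1 - t) / t) • y) := by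
      rw [smul_add, smul_smul, mul_div_cancel₀ _ ht']
    rw [hz, norm_smul, Real.norm_of_nonneg ht0]
    exact ht.trans_le (le_mul_of_one_le_right ht0 (h _))
end

section
/- Let X be a real normed linear space and let x, y be unit vectors in X with ‖x + λy‖ ≥ 1 for all real λ. Then ‖y + λx‖ ≥ 1/2 for all real λ. -/
/-- If x, y are unit vectors in a real normed linear space with x ⊥_B y, then
‖y + λx‖ ≥ 1/2 for all real λ. -/
theorem stmt_7 (X : Type*) [NormedAddCommGroup X] [NormedSpace ℝ X]
    (x y : X) (hx : ‖x‖ = 1) (hy : ‖y‖ = 1)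
    (h : ∀ l : ℝ, 1 ≤ ‖x + l • y‖) :
    ∀ l : ℝ, (1 : ℝ) / 2 ≤ ‖y + l • x‖ := by
  intro l
  have h_ge_abs : |l| ≤ ‖y + l • x‖ := by
    rcases eq_or_ne l 0 with rfl | hl
    · simp
    · have h_eq : y + l • x = l • (x + l⁻¹ • y) := by
        rw [smul_add, smul_inv_smul₀ hl, add_comm]
      rw [h_eq, norm_smul, Real.norm_eq_abs]
      exact le_mul_of_one_le_right (abs_nonneg l) (h l⁻¹)
  have h_triangle : ‖y‖ ≤ ‖y + l • x‖ + ‖l • x‖ := norm_le_add_norm_add y (l • x)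
  rw [norm_smul, hx, hy, Real.norm_eq_abs] at h_triangle
  linarith
end

section
/- Let X be a strictly convex real normed linear space and let x, y be unit vectors in X with ‖x + λy‖ ≥ 1 for all real λ. Then ‖y + λx‖ > 1/2 for all real λ. -/
/-- If `x` is a unit vector Birkhoff-James orthogonal to `y`, then `|l| ≤ ‖y + l • x‖`. -/
lemma abs_le_norm_add_smul_of_birkhoff {X : Type*} [NormedAddCommGroup X] [NormedSpace ℝ X]
    {x y : X} (h : ∀ l : ℝ, 1 ≤ ‖x + l • y‖) (l : ℝ) : |l| ≤ ‖y + l • x‖ := by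
  rcases eq_or_ne l 0 with rfl | hl
  · simp
  · have hyx : y + l • x = l • (x + l⁻¹ • y) := by
      rw [smul_add, smul_inv_smul₀ hl, add_comm]
    rw [hyx, norm_smul, Real.norm_eq_abs]
    exact le_mul_of_one_le_right (abs_nonneg l) (h _)

/-- If x, y are unit vectors in a strictly convex real normed linear space with x ⊥_B y,
then ‖y + λx‖ > 1/2 for all real λ. -/
theorem stmt_8 (X : Type*) [NormedAddCommGroup X] [NormedSpace ℝ X]
    [StrictConvexSpace ℝ X]
    (x y : X) (hx : ‖x‖ = 1) (hy : ‖y‖ = 1)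
    (h : ∀ l : ℝ, 1 ≤ ‖x + l • y‖) :
    ∀ l : ℝ, (1 : ℝ) / 2 < ‖y + l • x‖ := by
  intro l
  by_contra! hle
  have hl := abs_le_norm_add_smul_of_birkhoff h l
  have hsum : (y + l • x) + (-l) • x = y := by module
  have hv : ‖(-l) • x‖ = |l| := by rw [norm_smul, hx, mul_one, norm_neg, Real.norm_eq_abs]
  have htri := norm_add_le (y + l • x) ((-l) • x)
  rw [hsum, hy, hv] at htri
  have habs : |l| = 1 / 2 := by linarith
  have hnorm : ‖y + l • x‖ = 1 / 2 := by linarith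
  have heq : y + l • x = (-l) • x :=
    eq_of_norm_eq_of_norm_add_eq (by rw [hv, hnorm, habs])
      (by rw [hsum, hv, hnorm, habs, hy]; norm_num)
  have hyx : y = (-2 * l) • x := by
    rw [eq_sub_of_add_eq heq]
    module
  have hsq : 4 * l ^ 2 = 1 := by
    rw [← sq_abs, habs]
    norm_num
  have hzero : x + (2 * l) • y = 0 := by
    rw [hyx, show x + (2 * l) • (-2 * l) • x = (1 - 4 * l ^ 2) • x by module, hsq, sub_self,
      zero_smul]
  have hone := h (2 * l)
  rw [hzero, norm_zero] at hone
  linarith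
end

section
/- Let X be a finite-dimensional strictly convex real normed linear space of dimension at least 1. Then there exists δ > 1/3 such that for all unit vectors x, y in X with x ⊥_B y (i.e. ‖x + λy‖ ≥ 1 for all real λ) and all t ∈ [0,1], one has ‖tx + (1−t)y‖ ≥ δ. -/
theorem one_third_lt_norm_combo_of_birkhoffJames {X : Type*} [NormedAddCommGroup X]
    [NormedSpace ℝ X] [StrictConvexSpace ℝ X] {x y : X} (hx : ‖x‖ = 1) (hy : ‖y‖ = 1)
    (hxy : ∀ l : ℝ, 1 ≤ ‖x + l • y‖) {t : ℝ} (ht : t ∈ Set.Icc (0 : ℝ) 1) :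
    (1 : ℝ) / 3 < ‖t • x + (1 - t) • y‖ := by
  obtain ⟨ht0, ht1⟩ := ht
  by_contra! hle
  have hlower : t ≤ ‖t • x + (1 - t) • y‖ := by
    rcases ht0.eq_or_lt with rfl | hpos
    · exact norm_nonneg _
    · have heq : t • x + (1 - t) • y = t • (x + ((1 - t) / t) • y) := by
        rw [smul_add, smul_smul, mul_div_cancel₀ _ hpos.ne']
      rw [heq, norm_smul, Real.norm_of_nonneg ht0]
      exact le_mul_of_one_le_right ht0 (hxy _)
  have hupper : 1 - t - t ≤ ‖t • x + (1 - t) • y‖ := by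
    have h := norm_sub_le (t • x + (1 - t) • y) (t • x)
    rw [add_sub_cancel_left, norm_smul, norm_smul, hx, hy, Real.norm_of_nonneg ht0,
      Real.norm_of_nonneg (sub_nonneg.2 ht1)] at h
    linarith
  obtain rfl : t = 1 / 3 := by linarith
  have hnorm : ‖x + (2 : ℝ) • y‖ ≤ 1 := by
    have heq : x + (2 : ℝ) • y = (3 : ℝ) • ((1 / 3 : ℝ) • x + (1 - 1 / 3 : ℝ) • y) := by
      module
    rw [heq, norm_smul, Real.norm_of_nonneg (by norm_num)]
    linarith
  have hne : x ≠ x + (2 : ℝ) • y := by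
    have hy0 : y ≠ 0 := norm_ne_zero_iff.1 (by simp [hy])
    simpa using hy0
  have hlt := norm_combo_lt_of_ne (a := 1 / 2) (b := 1 / 2) hx.le hnorm hne
    (by norm_num) (by norm_num) (by norm_num)
  have heq : (1 / 2 : ℝ) • x + (1 / 2 : ℝ) • (x + (2 : ℝ) • y) = x + (1 : ℝ) • y := by
    module
  rw [heq] at hlt
  exact hlt.not_ge (hxy 1)

theorem isCompact_birkhoffJames_prod_Icc (X : Type*) [NormedAddCommGroup X] [NormedSpace ℝ X]
    [FiniteDimensional ℝ X] :
    IsCompact ({p : X × X | ‖p.1‖ = 1 ∧ ‖p.2‖ = 1 ∧ ∀ l : ℝ, 1 ≤ ‖p.1 + l • p.2‖} ×ˢ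
      Set.Icc (0 : ℝ) 1) := by
  have := FiniteDimensional.proper ℝ X
  refine IsCompact.prod ?_ isCompact_Icc
  refine ((isCompact_sphere (0 : X) 1).prod (isCompact_sphere (0 : X) 1)).of_isClosed_subset ?_
    fun p hp => ⟨mem_sphere_zero_iff_norm.2 hp.1, mem_sphere_zero_iff_norm.2 hp.2.1⟩
  simp only [Set.ofPred_and, Set.ofPred_forall]
  refine (isClosed_eq (by fun_prop) (by fun_prop)).inter
    ((isClosed_eq (by fun_prop) (by fun_prop)).inter (isClosed_iInter fun l => ?_))
  exact isClosed_le (by fun_prop) (by fun_prop)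

/-- In a finite-dimensional strictly convex real normed linear space of dimension ≥ 1,
there is a uniform δ > 1/3 with ‖tx + (1−t)y‖ ≥ δ for all unit x, y with x ⊥_B y
and all t ∈ [0,1]. -/
theorem stmt_11 (X : Type*) [NormedAddCommGroup X] [NormedSpace ℝ X]
    [FiniteDimensional ℝ X] [StrictConvexSpace ℝ X]
    (hdim : 1 ≤ Module.finrank ℝ X) :
    ∃ δ : ℝ, (1 : ℝ) / 3 < δ ∧
      ∀ x y : X, ‖x‖ = 1 → ‖y‖ = 1 → (∀ l : ℝ, 1 ≤ ‖x + l • y‖) →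
        ∀ t : ℝ, t ∈ Set.Icc (0 : ℝ) 1 → δ ≤ ‖t • x + (1 - t) • y‖ := by
  obtain ⟨δ, hδ, h⟩ := (isCompact_birkhoffJames_prod_Icc X).exists_forall_le'
    (f := fun q => ‖q.2 • q.1.1 + (1 - q.2) • q.1.2‖) (by fun_prop) (a := 1 / 3)
    fun q hq => one_third_lt_norm_combo_of_birkhoffJames hq.1.1 hq.1.2.1 hq.1.2.2 hq.2
  exact ⟨δ, hδ, fun x y hx hy hxy t ht => h ((x, y), t) ⟨⟨hx, hy, hxy⟩, ht⟩⟩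
end

section
/- Let X be a strictly convex real normed linear space of dimension 2 and let e₁, e₂ ∈ S_X. Then the diameters of S_X through e₁ and e₂ are conjugate (i.e. e₁ ⊥_B e₂ and e₂ ⊥_B e₁) if and only if {e₁, e₂} is a strongly orthonormal Hamel basis of X in the sense of Birkhoff-James (i.e. e₁, e₂ are linearly independent, and ‖e₁ + λe₂‖ > 1 and ‖e₂ + λe₁‖ > 1 for all real λ ≠ 0). -/
theorem one_lt_norm_add_smul_of_one_le {X : Type*} [NormedAddCommGroup X] [NormedSpace ℝ X]
    [StrictConvexSpace ℝ X] {x y : X} (hx : ‖x‖ = 1) (hy : y ≠ 0)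
    (h : ∀ l : ℝ, 1 ≤ ‖x + l • y‖) {l : ℝ} (hl : l ≠ 0) : 1 < ‖x + l • y‖ := by
  refine lt_of_le_of_ne (h l) fun heq => ?_
  have hne : x ≠ x + l • y := by simp [hl, hy]
  have hlt : ‖(1 / 2 : ℝ) • x + (1 / 2 : ℝ) • (x + l • y)‖ < 1 :=
    norm_combo_lt_of_ne hx.le heq.ge hne (by norm_num) (by norm_num) (by norm_num)
  have hmid : (1 / 2 : ℝ) • x + (1 / 2 : ℝ) • (x + l • y) = x + (l / 2) • y := by module
  rw [hmid] at hlt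
  exact (h (l / 2)).not_gt hlt

theorem linearIndependent_pair_of_one_le_norm_add_smul {X : Type*} [NormedAddCommGroup X]
    [NormedSpace ℝ X] {x y : X} (hy : y ≠ 0) (h : ∀ l : ℝ, 1 ≤ ‖x + l • y‖) :
    LinearIndependent ℝ ![x, y] := by
  refine LinearIndependent.pair_iff.2 fun s t hst => ?_
  have hs : s = 0 := by
    by_contra hs
    have hzero : x + (s⁻¹ * t) • y = 0 := by
      have := congrArg (s⁻¹ • ·) hst
      simpa [smul_add, smul_smul, hs] using this
    have := h (s⁻¹ * t)
    rw [hzero, norm_zero] at this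
    linarith
  subst hs
  simpa [hy] using hst


/-- In a two-dimensional strictly convex real normed linear space, the diameters of the
unit sphere through unit vectors e₁, e₂ are conjugate (e₁ ⊥_B e₂ and e₂ ⊥_B e₁) iff
{e₁, e₂} is a strongly orthonormal Hamel basis in the sense of Birkhoff-James. -/
theorem stmt_16 (X : Type*) [NormedAddCommGroup X] [NormedSpace ℝ X]
    [StrictConvexSpace ℝ X] (hdim : Module.finrank ℝ X = 2)
    (e₁ e₂ : X) (he₁ : ‖e₁‖ = 1) (he₂ : ‖e₂‖ = 1) :
    ((∀ l : ℝ, 1 ≤ ‖e₁ + l • e₂‖) ∧ (∀ l : ℝ, 1 ≤ ‖e₂ + l • e₁‖)) ↔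
      (LinearIndependent ℝ ![e₁, e₂] ∧
        (∀ l : ℝ, l ≠ 0 → 1 < ‖e₁ + l • e₂‖) ∧
        (∀ l : ℝ, l ≠ 0 → 1 < ‖e₂ + l • e₁‖)) := by
  have hne₁ : e₁ ≠ 0 := norm_ne_zero_iff.1 (by simp [he₁])
  have hne₂ : e₂ ≠ 0 := norm_ne_zero_iff.1 (by simp [he₂])
  constructor
  · rintro ⟨h₁, h₂⟩
    exact ⟨linearIndependent_pair_of_one_le_norm_add_smul hne₂ h₁,
      fun _ => one_lt_norm_add_smul_of_one_le he₁ hne₂ h₁,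
      fun _ => one_lt_norm_add_smul_of_one_le he₂ hne₁ h₂⟩
  · rintro ⟨-, h₁, h₂⟩
    refine ⟨fun l => ?_, fun l => ?_⟩
    · obtain rfl | hl := eq_or_ne l 0
      · simp [he₁]
      · exact (h₁ l hl).le
    · obtain rfl | hl := eq_or_ne l 0
      · simp [he₂]
      · exact (h₂ l hl).le
end

section
/- Let X be a strictly convex real normed linear space of dimension 2 which is smooth, meaning that for every x ∈ S_X there is a unique norm-one continuous linear functional f on X with f(x) = 1. Then Birkhoff-James orthogonality on X is symmetric (i.e. for all x, y ∈ X, x ⊥_B y implies y ⊥_B x; equivalently S_X is a Radon curve) if and only if for every x ∈ S_X there exists y ∈ S_X such that {x, y} is a strongly orthonormal Hamel basis of X in the sense of Birkhoff-James (i.e. ‖x + λy‖ > 1 and ‖y + λx‖ > 1 for all real λ ≠ 0). -/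
open Module in
theorem exists_smul_eq_of_mem_ker {X : Type*} [AddCommGroup X] [Module ℝ X]
    (hdim : finrank ℝ X = 2) {g : X →ₗ[ℝ] ℝ} {u v z : X} (hu : g u ≠ 0)
    (hv0 : v ≠ 0) (hv : g v = 0) (hz : g z = 0) : ∃ c : ℝ, c • v = z := by
  have : FiniteDimensional ℝ X := .of_finrank_pos (by omega)
  have hrange : finrank ℝ (LinearMap.range g) = 1 := by
    rw [LinearMap.range_eq_top.2 (LinearMap.surjective fun h => hu (by simp [h]))]
    simp
  have hker : finrank ℝ (LinearMap.ker g) = 1 := by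
    have := g.finrank_range_add_finrank_ker
    omega
  obtain ⟨c, hc⟩ := (finrank_eq_one_iff_of_nonzero' (⟨v, hv⟩ : LinearMap.ker g)
    (fun h => hv0 (congrArg Subtype.val h))).1 hker ⟨z, hz⟩
  exact ⟨c, congrArg Subtype.val hc⟩

open Module in
/-- In dimension two, Birkhoff-James orthogonality of a unit vector `u` to `v` is witnessed by a
supporting functional of `u` that vanishes at `v`. -/
theorem exists_supporting_functional_of_orthogonal {X : Type*} [NormedAddCommGroup X]
    [NormedSpace ℝ X] (hdim : finrank ℝ X = 2) {u v : X} (hu : ‖u‖ = 1) (hv0 : v ≠ 0)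
    (h : ∀ l : ℝ, ‖u‖ ≤ ‖u + l • v‖) :
    ∃ f : X →L[ℝ] ℝ, (‖f‖ = 1 ∧ f u = 1) ∧ f v = 0 := by
  have hlt : Submodule.span ℝ {v} < ⊤ := by
    refine lt_top_iff_ne_top.2 fun htop => ?_
    have := finrank_span_singleton (K := ℝ) hv0
    rw [htop, finrank_top] at this
    omega
  obtain ⟨g, hg0, hg⟩ := Submodule.exists_le_ker_of_lt_top _ hlt
  have hgv : g v = 0 := hg (Submodule.mem_span_singleton_self v)
  have hgu : g u ≠ 0 := by
    intro hgu
    obtain ⟨w, hw⟩ : ∃ w, g w ≠ 0 := by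
      by_contra! hw
      exact hg0 (LinearMap.ext hw)
    obtain ⟨c, rfl⟩ := exists_smul_eq_of_mem_ker hdim hw hv0 hgv hgu
    have := h (-c)
    rw [hu, ← add_smul] at this
    norm_num at this
  have hbound : ∀ z, ‖((g u)⁻¹ • g) z‖ ≤ 1 * ‖z‖ := by
    intro z
    set a := (g u)⁻¹ * g z with ha
    obtain ⟨c, hc⟩ := exists_smul_eq_of_mem_ker (z := z - a • u) hdim hgu hv0 hgv (by
      simp only [map_sub, map_smul, smul_eq_mul, ha]
      field_simp
      ring)
    have hz : z = a • u + c • v := by rw [hc]; abel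
    change ‖a‖ ≤ 1 * ‖z‖
    rw [one_mul]
    rcases eq_or_ne a 0 with h0 | h0
    · simp [h0]
    · have h1 := h (a⁻¹ * c)
      have hz' : z = a • (u + (a⁻¹ * c) • v) := by
        rw [hz, smul_add, smul_smul, mul_inv_cancel_left₀ h0]
      rw [hz', norm_smul]
      exact le_mul_of_one_le_right (norm_nonneg a) (hu ▸ h1)
  let f : X →L[ℝ] ℝ := ((g u)⁻¹ • g).mkContinuous 1 hbound
  have hfu : f u = 1 := by
    change (g u)⁻¹ * g u = 1
    exact inv_mul_cancel₀ hgu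
  have hfv : f v = 0 := by
    change (g u)⁻¹ * g v = 0
    rw [hgv, mul_zero]
  refine ⟨f, ⟨le_antisymm (LinearMap.mkContinuous_norm_le _ zero_le_one _) ?_, hfu⟩, hfv⟩
  simpa [hfu, hu] using f.le_opNorm u

/-- In a strictly convex space, Birkhoff-James orthogonality of nonzero vectors is strict. -/
theorem norm_lt_norm_add_smul_of_orthogonal {X : Type*} [NormedAddCommGroup X]
    [NormedSpace ℝ X] [StrictConvexSpace ℝ X] {x y : X} (hy : y ≠ 0)
    (h : ∀ l : ℝ, ‖x‖ ≤ ‖x + l • y‖) {l : ℝ} (hl : l ≠ 0) : ‖x‖ < ‖x + l • y‖ := by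
  refine (h l).lt_of_ne fun heq => ?_
  have hne : x ≠ x + l • y := by simp [hl, hy]
  have hlt := norm_combo_lt_of_ne le_rfl heq.ge hne (a := 1 / 2) (b := 1 / 2)
    (by norm_num) (by norm_num) (by norm_num)
  have hmid : (1 / 2 : ℝ) • x + (1 / 2 : ℝ) • (x + l • y) = x + (l / 2) • y := by module
  rw [hmid] at hlt
  exact hlt.not_ge (h _)

/-- Let X be a two-dimensional strictly convex smooth real normed linear space
(smooth: every unit vector has a unique norm-one supporting functional). Then
Birkhoff-James orthogonality is symmetric (the unit sphere is a Radon curve) iff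
every unit vector belongs to a strongly orthonormal Hamel basis in the sense of
Birkhoff-James. -/
theorem stmt_17 (X : Type*) [NormedAddCommGroup X] [NormedSpace ℝ X]
    [StrictConvexSpace ℝ X] (hdim : Module.finrank ℝ X = 2)
    (hsmooth : ∀ x : X, ‖x‖ = 1 → ∃! f : X →L[ℝ] ℝ, ‖f‖ = 1 ∧ f x = 1) :
    (∀ x y : X, (∀ l : ℝ, ‖x‖ ≤ ‖x + l • y‖) → (∀ l : ℝ, ‖y‖ ≤ ‖y + l • x‖)) ↔
      (∀ x : X, ‖x‖ = 1 → ∃ y : X, ‖y‖ = 1 ∧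
        (∀ l : ℝ, l ≠ 0 → 1 < ‖x + l • y‖) ∧
        (∀ l : ℝ, l ≠ 0 → 1 < ‖y + l • x‖)) := by
  have : FiniteDimensional ℝ X := .of_finrank_pos (by omega)
  constructor
  · intro hsymm x hx
    obtain ⟨f, ⟨hf, hfx⟩, -⟩ := hsmooth x hx
    obtain ⟨w, hw, hw0⟩ := Submodule.exists_mem_ne_zero_of_ne_bot
      (LinearMap.ker_ne_bot_of_finrank_lt (f := f.toLinearMap) (by simp [hdim]))
    have hfw : f w = 0 := hw
    set y := ‖w‖⁻¹ • w with hy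
    have hy1 : ‖y‖ = 1 := norm_smul_inv_norm (𝕜 := ℝ) hw0
    have hfy : f y = 0 := by rw [hy, map_smul, hfw, smul_zero]
    have hxy : ∀ l : ℝ, ‖x‖ ≤ ‖x + l • y‖ := by
      intro l
      have := f.le_opNorm (x + l • y)
      rw [map_add, map_smul, hfx, hfy, hf] at this
      simpa [hx] using this
    have hx0 : x ≠ 0 := by rintro rfl; simp at hx
    have hy0 : y ≠ 0 := by intro h; simp [h] at hy1
    refine ⟨y, hy1, fun l hl => ?_, fun l hl => ?_⟩
    · simpa only [hx] using norm_lt_norm_add_smul_of_orthogonal hy0 hxy hl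
    · simpa only [hy1] using norm_lt_norm_add_smul_of_orthogonal hx0 (hsymm x y hxy) hl
  · intro hbasis x y hxy l
    rcases eq_or_ne x 0 with rfl | hx0
    · simp
    rcases eq_or_ne y 0 with rfl | hy0
    · simp
    have hxn : ‖x‖ ≠ 0 := norm_ne_zero_iff.2 hx0
    set u := ‖x‖⁻¹ • x with hu
    have hu1 : ‖u‖ = 1 := norm_smul_inv_norm (𝕜 := ℝ) hx0
    have hxu : x = ‖x‖ • u := by rw [hu, smul_inv_smul₀ hxn]
    obtain ⟨v, hv1, huv, hvu⟩ := hbasis u hu1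
    have hv0 : v ≠ 0 := by rintro rfl; simp at hv1
    have huv' : ∀ l : ℝ, ‖u‖ ≤ ‖u + l • v‖ := by
      intro l
      rcases eq_or_ne l 0 with rfl | hl
      · simp
      · exact hu1.le.trans (huv l hl).le
    have huy : ∀ l : ℝ, ‖u‖ ≤ ‖u + l • y‖ := by
      intro l
      have h : u + l • y = ‖x‖⁻¹ • (x + (‖x‖ * l) • y) := by
        rw [smul_add, smul_smul, inv_mul_cancel_left₀ hxn]
      rw [h, hu, norm_smul, norm_smul]
      exact mul_le_mul_of_nonneg_left (hxy _) (norm_nonneg _)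
    obtain ⟨f, hf, hfv⟩ := exists_supporting_functional_of_orthogonal hdim hu1 hv0 huv'
    obtain ⟨g, hg, hgy⟩ := exists_supporting_functional_of_orthogonal hdim hu1 hy0 huy
    obtain rfl := (hsmooth u hu1).unique hf hg
    obtain ⟨c, rfl⟩ := exists_smul_eq_of_mem_ker (g := f.toLinearMap) (u := u) hdim
      (by simp [hf.2]) hv0 hfv hgy
    have hc : c ≠ 0 := by rintro rfl; simp at hy0
    have h : c • v + l • x = c • (v + (c⁻¹ * (l * ‖x‖)) • u) := by
      rw [smul_add, smul_smul, mul_inv_cancel_left₀ hc, mul_smul, ← hxu]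
    rw [h, norm_smul, norm_smul]
    refine mul_le_mul_of_nonneg_left ?_ (norm_nonneg _)
    rcases eq_or_ne (c⁻¹ * (l * ‖x‖)) 0 with h0 | h0
    · simp [h0]
    · exact hv1.le.trans (hvu _ h0).le
end
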